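/- There exists a bijection between the set of Motzkin excursions with catastrophes of length n and the set of Dyck paths of semilength n avoiding the factor UUU at height h ≥ 2; moreover it is induced by the bijection ψ from Motzkin meanders with catastrophes of length n to Dyck paths of semilength n+1 avoiding UUU at height ≥2, whose restriction to excursions yields exactly the paths ending with UD, followed by deletion of the final UD. -/

import Mathlib

/-- Every prefix of the path has nonnegative sum (the path stays weakly above the x-axis). -/
def NonnegPrefixes (w : List ℤ) : Prop := ∀ p ∈ w.inits, 0 ≤ p.sum

/-- A Dyck word: steps U = 1 and D = -1, nonnegative prefixes, ending at height 0. -/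
def IsDyckWord (w : List ℤ) : Prop :=
  (∀ s ∈ w, s = 1 ∨ s = -1) ∧ NonnegPrefixes w ∧ w.sum = 0

/-- A Motzkin path: steps U = 1, F = 0, D = -1, nonnegative prefixes, ending at height 0. -/
def IsMotzkinWord (w : List ℤ) : Prop :=
  (∀ s ∈ w, s = 1 ∨ s = 0 ∨ s = -1) ∧ NonnegPrefixes w ∧ w.sum = 0

/-- A Dyck meander with catastrophes: steps U = 1, D = -1, D_i = -i (i ≥ 2),
nonnegative, and every catastrophe step D_i (i ≥ 2) lands exactly at height 0. -/
def IsDyckMeanderCat (w : List ℤ) : Prop :=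
  (∀ s ∈ w, s = 1 ∨ s ≤ -1) ∧ NonnegPrefixes w ∧
    ∀ i, i < w.length → w.getD i 0 ≤ -2 → (w.take (i+1)).sum = 0

/-- A Motzkin meander with catastrophes: steps U = 1, F = 0, D = -1, D_i = -i (i ≥ 2),
nonnegative, every catastrophe landing exactly at height 0. -/
def IsMotzkinMeanderCat (w : List ℤ) : Prop :=
  (∀ s ∈ w, s ≤ 1) ∧ NonnegPrefixes w ∧
    ∀ i, i < w.length → w.getD i 0 ≤ -2 → (w.take (i+1)).sum = 0

def IsDyckExcursionCat (w : List ℤ) : Prop := IsDyckMeanderCat w ∧ w.sum = 0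

def IsMotzkinExcursionCat (w : List ℤ) : Prop := IsMotzkinMeanderCat w ∧ w.sum = 0

/-- The factor `pat` occurs in `w` starting at position `i`. -/
def OccursAt (pat w : List ℤ) (i : ℕ) : Prop := pat <+: w.drop i

/-- `w` has no occurrence of the factor `pat`. -/
def Avoids (pat w : List ℤ) : Prop := ∀ i, ¬ OccursAt pat w i

/-- `w` has no occurrence of `pat` starting at height h > 0. -/
def AvoidsAtPosHeight (pat w : List ℤ) : Prop :=
  ∀ i, OccursAt pat w i → (w.take i).sum ≤ 0

/-- `w` has no occurrence of `pat` starting at height h ≥ 2. -/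
def AvoidsAtHeightGe2 (pat w : List ℤ) : Prop :=
  ∀ i, OccursAt pat w i → (w.take i).sum < 2

def pUUU : List ℤ := [1, 1, 1]
def pDUD : List ℤ := [-1, 1, -1]
def pUUD : List ℤ := [1, 1, -1]
def pUD : List ℤ := [1, -1]
def pDU : List ℤ := [-1, 1]

/-- χ is the classical bijection sending Motzkin paths of length m to
Dyck paths of semilength m avoiding the factor UUU. -/
def ChiSpec (χ : List ℤ → List ℤ) : Prop :=
  ∀ m : ℕ, Set.BijOn χ {w | IsMotzkinWord w ∧ w.length = m}
    {w | IsDyckWord w ∧ w.length = 2 * m ∧ Avoids pUUU w}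

/-- The recursive equations defining the paper's map ψ from Motzkin meanders with
catastrophes to Dyck paths: ψ(ε) = UD; ψ(Fα) = UD ψ(α);
ψ(Uα₁Uα₂⋯Uα_k) = U (Uχ(α₁)D)(Uχ(α₂)D)⋯(Uχ(α_k)D) D;
ψ(Uα₁⋯Uα_k D_k β) = U (Uχ(α₁)D)⋯(Uχ(α_k)D) D ψ(β), with D₁ := D. -/
def PsiSpec (χ ψ : List ℤ → List ℤ) : Prop :=
  (ψ [] = [1, -1]) ∧
  (∀ α : List ℤ, IsMotzkinMeanderCat α → ψ (0 :: α) = 1 :: -1 :: ψ α) ∧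
  (∀ L : List (List ℤ), L ≠ [] → (∀ a ∈ L, IsMotzkinWord a) →
      ψ ((L.map (fun a => 1 :: a)).flatten) =
        1 :: ((L.map (fun a => 1 :: (χ a ++ [-1]))).flatten ++ [-1])) ∧
  (∀ (L : List (List ℤ)) (β : List ℤ), L ≠ [] → (∀ a ∈ L, IsMotzkinWord a) →
      IsMotzkinMeanderCat β →
      ψ ((L.map (fun a => 1 :: a)).flatten ++ (-(L.length : ℤ)) :: β) =
        1 :: ((L.map (fun a => 1 :: (χ a ++ [-1]))).flatten ++ -1 :: ψ β))

def Dk : ℤ → List ℤ → Prop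
  | h, [] => h = 0
  | h, s :: w => 0 ≤ h ∧ (s = 1 ∨ s = -1) ∧ Dk (h + s) w

def Mz : ℤ → List ℤ → Prop
  | h, [] => h = 0
  | h, s :: w => 0 ≤ h ∧ (s = 1 ∨ s = 0 ∨ s = -1) ∧ Mz (h + s) w

def Ex : ℤ → List ℤ → Prop
  | h, [] => h = 0
  | h, s :: w => 0 ≤ h ∧ s ≤ 1 ∧ (s ≤ -2 → h + s = 0) ∧ Ex (h + s) w

def A2 : ℤ → List ℤ → Prop
  | _, [] => True
  | h, s :: w => ([1, 1, 1] <+: s :: w → h < 2) ∧ A2 (h + s) w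

def A3 : List ℤ → Prop
  | [] => True
  | s :: w => ¬ [1, 1, 1] <+: s :: w ∧ A3 w

theorem inits_cons_iff (h s : ℤ) (w : List ℤ) :
    (∀ p ∈ (s :: w).inits, 0 ≤ h + p.sum) ↔ 0 ≤ h ∧ ∀ p ∈ w.inits, 0 ≤ (h + s) + p.sum := by
  simp [add_assoc]

theorem dk_iff (h : ℤ) (w : List ℤ) :
    Dk h w ↔ (∀ s ∈ w, s = 1 ∨ s = -1) ∧ (∀ p ∈ w.inits, 0 ≤ h + p.sum) ∧ h + w.sum = 0 := by
  induction w generalizing h with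
  | nil => simp [Dk]; omega
  | cons s w ih =>
    rw [Dk, ih, inits_cons_iff, List.forall_mem_cons, List.sum_cons, add_assoc h s w.sum]
    tauto

theorem mz_iff (h : ℤ) (w : List ℤ) :
    Mz h w ↔ (∀ s ∈ w, s = 1 ∨ s = 0 ∨ s = -1) ∧ (∀ p ∈ w.inits, 0 ≤ h + p.sum) ∧
      h + w.sum = 0 := by
  induction w generalizing h with
  | nil => simp [Mz]; omega
  | cons s w ih =>
    rw [Mz, ih, inits_cons_iff, List.forall_mem_cons, List.sum_cons, add_assoc h s w.sum]
    tauto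

theorem ex_iff (h : ℤ) (w : List ℤ) :
    Ex h w ↔ ((∀ s ∈ w, s ≤ 1) ∧ (∀ p ∈ w.inits, 0 ≤ h + p.sum) ∧
      ∀ i, i < w.length → w.getD i 0 ≤ -2 → h + (w.take (i+1)).sum = 0) ∧ h + w.sum = 0 := by
  induction w generalizing h with
  | nil => simp [Ex]; omega
  | cons s w ih =>
    have key : (∀ i, i < (s :: w).length → (s :: w).getD i 0 ≤ -2 →
        h + ((s :: w).take (i+1)).sum = 0) ↔ (s ≤ -2 → h + s = 0) ∧
        (∀ i, i < w.length → w.getD i 0 ≤ -2 → (h + s) + (w.take (i+1)).sum = 0) := by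
      constructor
      · intro H
        refine ⟨fun hs => by simpa using H 0 (by simp) (by simpa using hs), fun i hi hg => ?_⟩
        have := H (i+1) (by simpa using hi) (by simpa using hg)
        rw [List.take_succ_cons, List.sum_cons] at this
        omega
      · rintro ⟨H0, H⟩ i hi hg
        cases i with
        | zero => simpa using H0 (by simpa using hg)
        | succ i =>
          have := H i (by simpa using hi) (by simpa using hg)
          rw [List.take_succ_cons, List.sum_cons]
          omega
    rw [Ex, ih, inits_cons_iff, List.forall_mem_cons, List.sum_cons, add_assoc h s w.sum, key]
    tauto

theorem isDyck_iff (w : List ℤ) : IsDyckWord w ↔ Dk 0 w := by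
  simp [dk_iff, IsDyckWord, NonnegPrefixes]

theorem isMotzkin_iff (w : List ℤ) : IsMotzkinWord w ↔ Mz 0 w := by
  simp [mz_iff, IsMotzkinWord, NonnegPrefixes]

theorem isEx_iff (w : List ℤ) : IsMotzkinExcursionCat w ↔ Ex 0 w := by
  simp [ex_iff, IsMotzkinExcursionCat, IsMotzkinMeanderCat, NonnegPrefixes]

theorem a2_iff (h : ℤ) (w : List ℤ) :
    A2 h w ↔ ∀ i, OccursAt pUUU w i → h + (w.take i).sum < 2 := by
  induction w generalizing h with
  | nil => simp [A2, OccursAt, pUUU]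
  | cons s w ih =>
    rw [A2, ih]
    constructor
    · rintro ⟨H0, H⟩ i hi
      cases i with
      | zero => simpa using H0 hi
      | succ i =>
        have := H i hi
        rw [List.take_succ_cons, List.sum_cons]
        omega
    · intro H
      refine ⟨fun h0 => by simpa using H 0 h0, fun i hi => ?_⟩
      have := H (i+1) hi
      rw [List.take_succ_cons, List.sum_cons] at this
      omega

theorem a3_iff (w : List ℤ) : A3 w ↔ Avoids pUUU w := by
  induction w with
  | nil => simp [A3, Avoids, OccursAt, pUUU]
  | cons s w ih =>
    rw [A3, ih]
    constructor
    · rintro ⟨H0, H⟩ i hi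
      cases i with
      | zero => exact H0 hi
      | succ i => exact H i hi
    · intro H
      exact ⟨fun h0 => H 0 h0, fun i hi => H (i+1) hi⟩

theorem avoids2_iff (w : List ℤ) : AvoidsAtHeightGe2 pUUU w ↔ A2 0 w := by
  simp [a2_iff, AvoidsAtHeightGe2]

theorem dk_nonneg {h w} (H : Dk h w) : 0 ≤ h := by
  cases w with
  | nil => exact le_of_eq H.symm
  | cons => exact H.1

theorem mz_nonneg {h w} (H : Mz h w) : 0 ≤ h := by
  cases w with
  | nil => exact le_of_eq H.symm
  | cons => exact H.1

theorem ex_nonneg {h w} (H : Ex h w) : 0 ≤ h := by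
  cases w with
  | nil => exact le_of_eq H.symm
  | cons => exact H.1

theorem dk_append {h k a b} (ha : Dk h a) (hb : Dk k b) : Dk (h + k) (a ++ b) := by
  induction a generalizing h with
  | nil => cases ha; simpa using hb
  | cons s a ih =>
    obtain ⟨h1, h2, h3⟩ := ha
    have := dk_nonneg hb
    refine ⟨by omega, h2, ?_⟩
    have := ih h3
    rwa [add_right_comm] at this

theorem mz_append {h k a b} (ha : Mz h a) (hb : Mz k b) : Mz (h + k) (a ++ b) := by
  induction a generalizing h with
  | nil => cases ha; simpa using hb
  | cons s a ih =>
    obtain ⟨h1, h2, h3⟩ := ha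
    have := mz_nonneg hb
    refine ⟨by omega, h2, ?_⟩
    have := ih h3
    rwa [add_right_comm] at this

theorem mz_ex_append {h k a b} (ha : Mz h a) (hb : Ex k b) : Ex (h + k) (a ++ b) := by
  induction a generalizing h with
  | nil => cases ha; simpa using hb
  | cons s a ih =>
    obtain ⟨h1, h2, h3⟩ := ha
    have := ex_nonneg hb
    refine ⟨by omega, by omega, by omega, ?_⟩
    have := ih h3
    rwa [add_right_comm] at this

theorem dk_sum {h w} (H : Dk h w) : h + w.sum = 0 := ((dk_iff h w).1 H).2.2

theorem a2_sep (h : ℤ) (d x : List ℤ) :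
    A2 h (d ++ -1 :: x) ↔ A2 h d ∧ A2 (h + d.sum - 1) x := by
  induction d generalizing h with
  | nil => simp [A2, sub_eq_add_neg]
  | cons s d ih =>
    have key : [1,1,1] <+: s :: d ++ -1 :: x ↔ [1,1,1] <+: s :: d := by
      rcases d with _ | ⟨t, _ | ⟨u, d⟩⟩ <;> simp
    have key' : [1,1,1] <+: s :: (d ++ -1 :: x) ↔ [1,1,1] <+: s :: d := key
    rw [List.cons_append, A2, A2, ih, key', List.sum_cons, ← add_assoc h s d.sum]
    tauto

theorem a2_a3 (h k : ℤ) (hk : k + 2 ≤ h) (d : List ℤ) (hd : Dk k d) : A2 h d ↔ A3 d := by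
  induction d generalizing h k with
  | nil => simp [A2, A3]
  | cons s d ih =>
    have h0 : ¬ h < 2 := by have := hd.1; omega
    rw [A2, A3, ih (h + s) (k + s) (by omega) hd.2.2]
    simp [h0]

theorem a2_UD (h : ℤ) (v : List ℤ) (hv : Dk h v) : A2 h (v ++ [1, -1]) ↔ A2 h v := by
  induction v generalizing h with
  | nil => simp [A2]
  | cons s v ih =>
    have h2 := hv.2.2
    have key : [1,1,1] <+: s :: (v ++ [1, -1]) ↔ [1,1,1] <+: s :: v := by
      rcases v with _ | ⟨t, _ | ⟨u, d⟩⟩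
      · simp
      · simp only [Dk] at hv
        simp
        omega
      · simp
    rw [List.cons_append, A2, A2, ih _ h2, key]

theorem dk_UD (h : ℤ) (v : List ℤ) : Dk h (v ++ [1, -1]) ↔ Dk h v := by
  induction v generalizing h with
  | nil => simp [Dk]; omega
  | cons s v ih => rw [List.cons_append, Dk, Dk, ih]

/-- flattening -/
def fl (L : List (List ℤ)) : List ℤ := (L.map (fun a => 1 :: a)).flatten
def fd (L : List (List ℤ)) : List ℤ := (L.map (fun a => 1 :: (a ++ [-1]))).flatten

theorem fd_cons (a L x) : fd (a :: L) ++ x = 1 :: (a ++ -1 :: (fd L ++ x)) := by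
  simp [fd]

theorem fl_cons (a L x) : fl (a :: L) ++ x = 1 :: (a ++ (fl L ++ x)) := by
  simp [fl]

theorem fl_append (L M) : fl (L ++ M) = fl L ++ fl M := by simp [fl]

theorem fl_one (a) : fl [a] = 1 :: a := by simp [fl]

theorem ex_parse (w : List ℤ) (L : List (List ℤ)) (a : List ℤ) (hL : ∀ b ∈ L, Mz 0 b)
    (ha : Mz 0 a) (hw : Ex (L.length + 1) w) :
    ∃ (M : List (List ℤ)) (β : List ℤ), (∀ b ∈ M, Mz 0 b) ∧ M ≠ [] ∧
      fl L ++ 1 :: (a ++ w) = fl M ++ (-(M.length : ℤ)) :: β ∧ Ex 0 β ∧ β.length ≤ w.length := by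
  induction w generalizing L a with
  | nil => simp only [Ex] at hw; omega
  | cons s w ih =>
    obtain ⟨-, h1, h2, h3⟩ := hw
    by_cases hz : (L.length : ℤ) + 1 + s = 0
    · refine ⟨L ++ [a], w, ?_, by simp, ?_, by rwa [hz] at h3, by simp⟩
      · intro b hb
        rcases List.mem_append.1 hb with hb | hb
        · exact hL b hb
        · rw [List.mem_singleton.1 hb]; exact ha
      · have : s = -((L ++ [a]).length : ℤ) := by
          rw [List.length_append, List.length_singleton]; push_cast; omega
        rw [← this, fl_append, fl_one]; simp
    · have hs : s = 1 ∨ s = 0 ∨ s = -1 := by omega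
      rcases hs with rfl | rfl | rfl
      · obtain ⟨M, β, q1, q2, q3, q4, q5⟩ := ih (L ++ [a]) [] (by
          intro b hb
          rcases List.mem_append.1 hb with hb | hb
          · exact hL b hb
          · rw [List.mem_singleton.1 hb]; exact ha) rfl (by
          rw [List.length_append, List.length_singleton]; push_cast; exact h3)
        refine ⟨M, β, q1, q2, ?_, q4, by simp; omega⟩
        rw [← q3, fl_append, fl_one]; simp
      · obtain ⟨M, β, q1, q2, q3, q4, q5⟩ := ih L (a ++ [0]) hL
          (by simpa using mz_append ha (show Mz 0 [0] by simp [Mz])) (by simpa using h3)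
        refine ⟨M, β, q1, q2, ?_, q4, by simp; omega⟩
        rw [← q3]; simp
      · rcases List.eq_nil_or_concat L with rfl | ⟨L', b, rfl⟩
        · simp at hz
        · simp only [List.concat_eq_append] at *
          have m1 : Mz 0 (1 :: (a ++ [-1])) := by
            refine ⟨le_refl _, Or.inl rfl, ?_⟩
            simpa using mz_append ha (show Mz 1 [-1] by simp [Mz])
          have m2 := mz_append (hL b (by simp)) m1
          obtain ⟨M, β, q1, q2, q3, q4, q5⟩ := ih L' (b ++ 1 :: (a ++ [-1]))
            (fun c hc => hL c (by simp [hc])) (by simpa using m2)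
            (by rw [List.length_append, List.length_singleton] at h3; push_cast at h3
                simpa using h3)
          refine ⟨M, β, q1, q2, ?_, q4, by simp; omega⟩
          rw [← q3, fl_append, fl_one]; simp

inductive PsiRel (χ : List ℤ → List ℤ) : List ℤ → List ℤ → Prop
  | nil : PsiRel χ [] []
  | cons (L w v) (hL : ∀ a ∈ L, Mz 0 a) (h : PsiRel χ w v) :
      PsiRel χ (fl L ++ (-(L.length : ℤ)) :: w) (1 :: (fd (L.map χ) ++ -1 :: v))

theorem rel_total (χ) (n : ℕ) : ∀ w : List ℤ, w.length ≤ n → Ex 0 w → ∃ v, PsiRel χ w v := by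
  induction n with
  | zero =>
    intro w hw _
    rw [List.length_eq_zero_iff.1 (Nat.le_zero.1 hw)]
    exact ⟨_, PsiRel.nil⟩
  | succ n ih =>
    intro w hw hE
    rcases w with _ | ⟨s, w⟩
    · exact ⟨_, PsiRel.nil⟩
    · obtain ⟨-, h1, h2, h3⟩ := hE
      have := ex_nonneg h3
      simp only [List.length_cons] at hw
      have hs : s = 0 ∨ s = 1 := by omega
      rcases hs with rfl | rfl
      · obtain ⟨v, hv⟩ := ih w (by omega) (by simpa using h3)
        exact ⟨_, by simpa [fl] using PsiRel.cons [] w v (by simp) hv⟩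
      · obtain ⟨M, β, q1, q2, q3, q4, q5⟩ := ex_parse w [] [] (by simp) rfl (by simpa using h3)
        obtain ⟨v, hv⟩ := ih β (by omega) q4
        have q3' : 1 :: w = fl M ++ (-(M.length : ℤ)) :: β := by simpa [fl] using q3
        rw [q3']
        exact ⟨_, PsiRel.cons M β v q1 hv⟩

theorem ex_fl (L : List (List ℤ)) (w) (hL : ∀ a ∈ L, Mz 0 a) (hw : Ex 0 w) (k : ℤ) (hk : 0 ≤ k) :
    Ex k (fl L ++ (-(k + L.length)) :: w) := by
  induction L generalizing k with
  | nil =>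
    refine ⟨hk, ?_, ?_, ?_⟩ <;> simp
    · omega
    · exact hw
  | cons a L ih =>
    rw [fl_cons]
    refine ⟨hk, by simp, by simp, ?_⟩
    have := mz_ex_append (hL a (by simp)) (ih (fun b hb => hL b (by simp [hb])) (k+1) (by omega))
    rw [zero_add] at this
    convert this using 5
    push_cast [List.length_cons]; ring

theorem rel_ex {χ w v} (H : PsiRel χ w v) : Ex 0 w := by
  induction H with
  | nil => rfl
  | cons L w v hL _ ih => simpa using ex_fl L w hL ih 0 le_rfl

section
variable {χ ψ : List ℤ → List ℤ}

theorem chi_spec (hχ : ChiSpec χ) {a} (ha : Mz 0 a) :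
    Dk 0 (χ a) ∧ (χ a).length = 2 * a.length ∧ A3 (χ a) := by
  have := (hχ a.length).mapsTo (show a ∈ {w | IsMotzkinWord w ∧ w.length = a.length} from
    ⟨(isMotzkin_iff a).2 ha, rfl⟩)
  obtain ⟨h1, h2, h3⟩ := this
  exact ⟨(isDyck_iff _).1 h1, h2, (a3_iff _).2 h3⟩

theorem chi_inj (hχ : ChiSpec χ) {a b} (ha : Mz 0 a) (hb : Mz 0 b) (h : χ a = χ b) : a = b := by
  have h1 := (chi_spec hχ ha).2.1
  have h2 := (chi_spec hχ hb).2.1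
  rw [h] at h1
  exact (hχ a.length).injOn ⟨(isMotzkin_iff a).2 ha, rfl⟩
    ⟨(isMotzkin_iff b).2 hb, by omega⟩ h

theorem chi_surj (hχ : ChiSpec χ) {d} (hd : Dk 0 d) (m : ℕ) (hm : d.length = 2 * m) (h3 : A3 d) :
    ∃ a, Mz 0 a ∧ χ a = d := by
  obtain ⟨a, ha, h⟩ := (hχ m).surjOn (show d ∈ _ from ⟨(isDyck_iff _).2 hd, hm, (a3_iff _).1 h3⟩)
  exact ⟨a, (isMotzkin_iff a).1 ha.1, h⟩

theorem rel_psi (hψ : PsiSpec χ ψ) {w v} (H : PsiRel χ w v) : ψ w = v ++ [1, -1] := by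
  obtain ⟨p1, p2, -, p4⟩ := hψ
  induction H with
  | nil => simpa using p1
  | cons L w v hL hr ih =>
    have hm := ((isEx_iff w).2 (rel_ex hr)).1
    by_cases h0 : L = []
    · subst h0
      simpa [fl, fd, ih] using p2 w hm
    · have := p4 L w h0 (fun a ha => (isMotzkin_iff a).2 (hL a ha)) hm
      rw [ih] at this
      simpa [fl, fd, Function.comp_def] using this

theorem fd_len (hχ : ChiSpec χ) (L : List (List ℤ)) (hL : ∀ a ∈ L, Mz 0 a) :
    (fd (L.map χ)).length = 2 * (fl L).length := by
  induction L with
  | nil => simp [fd, fl]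
  | cons a L ih =>
    have h1 := (chi_spec hχ (hL a (by simp))).2.1
    have h2 := ih (fun b hb => hL b (by simp [hb]))
    have e1 := fd_cons (χ a) (L.map χ) []
    have e2 := fl_cons a L []
    simp only [List.append_nil] at e1 e2
    rw [List.map_cons, e1, e2]
    simp only [List.length_cons, List.length_append, h1, h2]
    ring

theorem rel_len (hχ : ChiSpec χ) {w v} (H : PsiRel χ w v) : v.length = 2 * w.length := by
  induction H with
  | nil => rfl
  | cons L w v hL hr ih =>
    have := fd_len hχ L hL
    simp only [List.length_cons, List.length_append, ih, this]
    ring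

theorem fd_good (L : List (List ℤ)) (x) (hL : ∀ a ∈ L, Dk 0 a ∧ A3 a) (hx : Dk 1 x)
    (hx' : A2 1 x) : Dk 1 (fd L ++ x) ∧ A2 1 (fd L ++ x) := by
  induction L with
  | nil => exact ⟨hx, hx'⟩
  | cons a L ih =>
    obtain ⟨h1, h2⟩ := ih (fun b hb => hL b (by simp [hb]))
    obtain ⟨h3, h4⟩ := hL a (by simp)
    rw [fd_cons]
    refine ⟨⟨by simp, Or.inl rfl, ?_⟩, fun _ => by simp, ?_⟩
    · simpa using dk_append h3 (show Dk 2 (-1 :: (fd L ++ x)) from ⟨by simp, Or.inr rfl, h1⟩)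
    · have := dk_sum h3
      rw [zero_add] at this
      rw [a2_sep, this, a2_a3 _ 0 (by simp) a h3]
      exact ⟨h4, by simpa using h2⟩

theorem rel_good (hχ : ChiSpec χ) {w v} (H : PsiRel χ w v) : Dk 0 v ∧ A2 0 v := by
  induction H with
  | nil => exact ⟨rfl, trivial⟩
  | cons L w v hL hr ih =>
    have := fd_good (L.map χ) (-1 :: v) (by
      intro a ha
      obtain ⟨b, hb, rfl⟩ := List.mem_map.1 ha
      have := chi_spec hχ (hL b hb)
      exact ⟨this.1, this.2.2⟩) ⟨by simp, Or.inr rfl, by simpa using ih.1⟩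
      ⟨by simp, by simpa using ih.2⟩
    exact ⟨⟨le_rfl, Or.inl rfl, this.1⟩, fun _ => by simp, this.2⟩

theorem dk_uniq {h a b x y} (ha : Dk h a) (hb : Dk h b) (e : a ++ -1 :: x = b ++ -1 :: y) :
    a = b ∧ x = y := by
  induction a generalizing h b with
  | nil =>
    rcases b with _ | ⟨t, b⟩
    · simpa using e
    · simp only [List.nil_append, List.cons_append, List.cons.injEq] at e
      have := dk_nonneg hb.2.2
      simp only [Dk] at ha
      omega
  | cons s a ih =>
    rcases b with _ | ⟨t, b⟩
    · simp only [List.nil_append, List.cons_append, List.cons.injEq] at e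
      have := dk_nonneg ha.2.2
      simp only [Dk] at hb
      omega
    · simp only [List.cons_append, List.cons.injEq] at e
      obtain ⟨rfl, e⟩ := e
      obtain ⟨rfl, rfl⟩ := ih ha.2.2 hb.2.2 e
      simp

theorem fd_uniq (hχ : ChiSpec χ) (L M : List (List ℤ)) (x y) (hL : ∀ a ∈ L, Mz 0 a)
    (hM : ∀ a ∈ M, Mz 0 a) (e : fd (L.map χ) ++ -1 :: x = fd (M.map χ) ++ -1 :: y) :
    L = M ∧ x = y := by
  induction L generalizing M with
  | nil =>
    rcases M with _ | ⟨b, M⟩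
    · simpa [fd] using e
    · simp [fd] at e
  | cons a L ih =>
    rcases M with _ | ⟨b, M⟩
    · simp [fd] at e
    · rw [List.map_cons, List.map_cons, fd_cons, fd_cons] at e
      have ha := hL a (by simp)
      have hb := hM b (by simp)
      obtain ⟨e1, e2⟩ := dk_uniq (chi_spec hχ ha).1 (chi_spec hχ hb).1 (List.cons.inj e).2
      obtain ⟨rfl, rfl⟩ := ih M (fun c hc => hL c (by simp [hc])) (fun c hc => hM c (by simp [hc])) e2
      rw [chi_inj hχ ha hb e1]
      simp

theorem rel_inj (hχ : ChiSpec χ) {w w' v} (H : PsiRel χ w v) (H' : PsiRel χ w' v) : w = w' := by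
  induction H generalizing w' with
  | nil => cases H'; rfl
  | cons L w v hL hr ih =>
    generalize hu : (1 :: (fd (L.map χ) ++ -1 :: v)) = u at H'
    cases H' with
    | nil => simp at hu
    | cons L' w' v' hL' hr' =>
      obtain ⟨rfl, rfl⟩ := fd_uniq hχ L L' v v' hL hL' (List.cons.inj hu).2
      rw [ih hr']

theorem dk_split (n : ℕ) : ∀ (v : List ℤ) (h : ℤ), v.length ≤ n → 0 ≤ h → Dk (h + 1) v →
    ∃ d x, v = d ++ -1 :: x ∧ Dk 0 d ∧ Dk h x := by
  induction n with
  | zero =>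
    intro v h hn hh hv
    rw [List.length_eq_zero_iff.1 (Nat.le_zero.1 hn)] at hv
    simp only [Dk] at hv; omega
  | succ n ih =>
    intro v h hn hh hv
    rcases v with _ | ⟨s, v⟩
    · simp only [Dk] at hv; omega
    · obtain ⟨-, rfl | rfl, h3⟩ := hv
      · simp only [List.length_cons] at hn
        obtain ⟨d, x, rfl, hd, hx⟩ := ih v (h+1) (by omega) (by omega) h3
        simp only [List.length_cons, List.length_append] at hn
        obtain ⟨d', x', rfl, hd', hx'⟩ := ih x h (by omega) hh hx
        refine ⟨1 :: (d ++ -1 :: d'), x', by simp, ⟨le_rfl, Or.inl rfl, ?_⟩, hx'⟩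
        simpa using dk_append hd (show Dk 1 (-1 :: d') from ⟨by simp, Or.inr rfl, by simpa using hd'⟩)
      · exact ⟨[], v, by simp, rfl, by simpa using h3⟩

theorem dk_even {h d} (hd : Dk h d) : ∃ m : ℤ, (d.length : ℤ) = 2 * m + h := by
  induction d generalizing h with
  | nil => cases hd; exact ⟨0, by simp⟩
  | cons s d ih =>
    obtain ⟨m, hm⟩ := ih hd.2.2
    rcases hd.2.1 with rfl | rfl
    · exact ⟨m + 1, by push_cast [List.length_cons]; omega⟩
    · exact ⟨m, by push_cast [List.length_cons]; omega⟩

theorem dk_parse (hχ : ChiSpec χ) (n : ℕ) : ∀ v : List ℤ, v.length ≤ n → Dk 1 v → A2 1 v →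
    ∃ (L : List (List ℤ)) (x : List ℤ), (∀ a ∈ L, Mz 0 a) ∧ v = fd (L.map χ) ++ -1 :: x ∧ Dk 0 x ∧ A2 0 x := by
  induction n with
  | zero =>
    intro v hn hv
    rw [List.length_eq_zero_iff.1 (Nat.le_zero.1 hn)] at hv
    simp [Dk] at hv
  | succ n ih =>
    intro v hn hv hA
    rcases v with _ | ⟨s, v⟩
    · simp [Dk] at hv
    · obtain ⟨-, rfl | rfl, h3⟩ := hv
      · simp only [List.length_cons] at hn
        obtain ⟨d, x, rfl, hd, hx⟩ := dk_split v.length v 1 le_rfl (by simp) h3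
        simp only [List.length_cons, List.length_append] at hn
        have hA2 := hA.2
        have hs := dk_sum hd
        rw [zero_add] at hs
        rw [a2_sep, hs, a2_a3 _ 0 (by simp) d hd] at hA2
        obtain ⟨L, y, q1, rfl, q3, q4⟩ := ih x (by omega) hx (by simpa using hA2.2)
        obtain ⟨m, hm⟩ := dk_even hd
        obtain ⟨a, ha, rfl⟩ := chi_surj hχ hd m.toNat (by omega) hA2.1
        refine ⟨a :: L, y, ?_, ?_, q3, q4⟩
        · intro b hb
          rcases List.mem_cons.1 hb with rfl | hb
          · exact ha
          · exact q1 b hb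
        · rw [List.map_cons, fd_cons]
      · exact ⟨[], v, by simp, by simp [fd], by simpa using h3, by simpa using hA.2⟩

theorem rel_surj (hχ : ChiSpec χ) (n : ℕ) : ∀ v : List ℤ, v.length ≤ n → Dk 0 v → A2 0 v →
    ∃ w, PsiRel χ w v := by
  induction n with
  | zero =>
    intro v hn _ _
    rw [List.length_eq_zero_iff.1 (Nat.le_zero.1 hn)]
    exact ⟨_, PsiRel.nil⟩
  | succ n ih =>
    intro v hn hv hA
    rcases v with _ | ⟨s, v⟩
    · exact ⟨_, PsiRel.nil⟩
    · obtain ⟨-, h1, h3⟩ := hv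
      have := dk_nonneg h3
      have hs : s = 1 := by omega
      subst hs
      obtain ⟨L, x, q1, rfl, q3, q4⟩ := dk_parse hχ v.length v le_rfl (by simpa using h3)
        (by simpa using hA.2)
      simp only [List.length_cons, List.length_append] at hn
      obtain ⟨w, hw⟩ := ih x (by omega) q3 q4
      exact ⟨_, PsiRel.cons L w x q1 hw⟩

end

/-- Motzkin excursions with catastrophes of length n are in bijection with Dyck paths
of semilength n avoiding UUU at height h ≥ 2; the bijection is induced by ψ: the
image under ψ of the excursions is exactly the set of paths of semilength n+1 in the
family that end with UD, and deleting this final UD gives the bijection. -/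
theorem stmt_13 (χ ψ : List ℤ → List ℤ) (hχ : ChiSpec χ) (hψ : PsiSpec χ ψ) (n : ℕ) :
    ψ '' {w | IsMotzkinExcursionCat w ∧ w.length = n} =
      {w | IsDyckWord w ∧ w.length = 2 * (n + 1) ∧ AvoidsAtHeightGe2 pUUU w ∧
        [1, -1] <:+ w} ∧
    Set.BijOn (fun w => ((ψ w).dropLast).dropLast)
      {w | IsMotzkinExcursionCat w ∧ w.length = n}
      {w | IsDyckWord w ∧ w.length = 2 * n ∧ AvoidsAtHeightGe2 pUUU w} := by

  have tot : ∀ w, IsMotzkinExcursionCat w → ∃ v, PsiRel χ w v := fun w hw =>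
    rel_total χ w.length w le_rfl ((isEx_iff w).1 hw)
  have drop : ∀ v : List ℤ, ((v ++ [1, -1]).dropLast).dropLast = v := by
    intro v
    have : v ++ [(1 : ℤ), -1] = (v ++ [1]) ++ [-1] := by simp
    rw [this, List.dropLast_concat, List.dropLast_concat]
  refine ⟨?_, ?_, ?_, ?_⟩
  · ext u
    constructor
    · rintro ⟨w, ⟨hw, rfl⟩, rfl⟩
      obtain ⟨v, hv⟩ := tot w hw
      obtain ⟨g1, g2⟩ := rel_good hχ hv
      have hl := rel_len hχ hv
      rw [rel_psi hψ hv]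
      refine ⟨(isDyck_iff _).2 ((dk_UD 0 v).2 g1), ?_, (avoids2_iff _).2 ((a2_UD 0 v g1).2 g2),
        List.suffix_append _ _⟩
      simp [hl]; ring
    · rintro ⟨h1, h2, h3, v, rfl⟩
      have g1 := (dk_UD 0 v).1 ((isDyck_iff _).1 h1)
      have g2 := (a2_UD 0 v g1).1 ((avoids2_iff _).1 h3)
      obtain ⟨w, hw⟩ := rel_surj hχ v.length v le_rfl g1 g2
      have hl := rel_len hχ hw
      refine ⟨w, ⟨(isEx_iff w).2 (rel_ex hw), ?_⟩, rel_psi hψ hw⟩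
      simp at h2
      omega
  · rintro w ⟨hw, rfl⟩
    obtain ⟨v, hv⟩ := tot w hw
    obtain ⟨g1, g2⟩ := rel_good hχ hv
    have hl := rel_len hχ hv
    simp only [rel_psi hψ hv, drop]
    exact ⟨(isDyck_iff _).2 g1, hl, (avoids2_iff _).2 g2⟩
  · rintro w ⟨hw, -⟩ w' ⟨hw', -⟩ e
    obtain ⟨v, hv⟩ := tot w hw
    obtain ⟨v', hv'⟩ := tot w' hw'
    simp only [rel_psi hψ hv, rel_psi hψ hv', drop] at e
    subst e
    exact rel_inj hχ hv hv'
  · rintro v ⟨h1, h2, h3⟩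
    obtain ⟨w, hw⟩ := rel_surj hχ v.length v le_rfl ((isDyck_iff _).1 h1) ((avoids2_iff _).1 h3)
    have hl := rel_len hχ hw
    refine ⟨w, ⟨(isEx_iff w).2 (rel_ex hw), by omega⟩, ?_⟩
    simp only [rel_psi hψ hw, drop]
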